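/- Let G = (V,E) be a finite simple graph on {1,…,ℓ} and let e ∈ E be an edge that is not an edge of any induced 4-cycle of G. If the projective dimension of D(A(G)) is at most 1, then the projective dimension of D(A(G − e)) is also at most 1, where G − e = (V, E ∖ {e}). -/

import Mathlib

open MvPolynomial CategoryTheory

/-- The polynomial ring `S = ℚ[x_1, …, x_ℓ]` (variables indexed by `Fin ℓ`). -/
abbrev Spoly (ℓ : ℕ) : Type := MvPolynomial (Fin ℓ) ℚ

/-- The module `D(A(G))` of logarithmic derivations of the graphic arrangement of a
graph `G` on the vertex set `{1, …, ℓ}`: all `θ ∈ Der_ℚ(S)` such that `(x_i - x_j)`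
divides `θ(x_i) - θ(x_j)` for every edge `{i, j}` of `G`. -/
noncomputable def logDer (ℓ : ℕ) (G : SimpleGraph (Fin ℓ)) :
    Submodule (Spoly ℓ) (Derivation ℚ (Spoly ℓ) (Spoly ℓ)) where
  carrier := {θ | ∀ i j : Fin ℓ, G.Adj i j → (X i - X j) ∣ θ (X i) - θ (X j)}
  add_mem' := by
    intro a b ha hb i j h
    have : (a + b) (X i) - (a + b) (X j)
        = (a (X i) - a (X j)) + (b (X i) - b (X j)) := by
      simp only [Derivation.add_apply]; ring
    rw [this]
    exact dvd_add (ha i j h) (hb i j h)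
  zero_mem' := by intro i j h; simp
  smul_mem' := by
    intro c θ hθ i j h
    have : (c • θ) (X i) - (c • θ) (X j) = c * (θ (X i) - θ (X j)) := by
      simp only [Derivation.smul_apply, smul_eq_mul]; ring
    rw [this]
    exact (hθ i j h).mul_left c

/-- `pdLE M n` : `M` admits a projective resolution vanishing in homological
degrees above `n`, i.e. the projective dimension of `M` is at most `n`. -/
def pdLE {R : Type} [CommRing R] (M : ModuleCat R) (n : ℕ) : Prop :=
  ∃ P : ProjectiveResolution M, ∀ i : ℕ, n < i → Limits.IsZero (P.complex.X i)

/-- The projective dimension of a module, as an element of `ℕ∞`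
(infimum of the lengths of projective resolutions; `⊤` if there is none of finite length). -/
noncomputable def pd {R : Type} [CommRing R] (M : ModuleCat R) : ℕ∞ :=
  sInf {n : ℕ∞ | ∃ k : ℕ, (k : ℕ∞) = n ∧ pdLE M k}

section Resolution

open scoped ZeroObject

variable {C : Type*} [Category* C] [Abelian C]

/-- The chain complex `⋯ ⟶ 0 ⟶ P₁ ⟶ P₀`. -/
noncomputable def twoTermComplex {P₁ P₀ : C} (d : P₁ ⟶ P₀) : ChainComplex C ℕ :=
  ChainComplex.mk' P₀ P₁ d (fun _ => ⟨0, 0, by simp⟩)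

lemma twoTermComplex_d {P₁ P₀ : C} (d : P₁ ⟶ P₀) : (twoTermComplex d).d 1 0 = d := by
  simp [twoTermComplex]

lemma isZero_twoTermComplex_X {P₁ P₀ : C} (d : P₁ ⟶ P₀) (n : ℕ) :
    Limits.IsZero ((twoTermComplex d).X (n + 2)) := by
  obtain _ | n := n <;> exact Limits.isZero_zero C

lemma twoTermComplex_exactAt_succ {P₁ P₀ : C} (d : P₁ ⟶ P₀) [Mono d] (n : ℕ) :
    (twoTermComplex d).ExactAt (n + 1) := by
  rw [HomologicalComplex.exactAt_iff' _ (n + 1 + 1) (n + 1) n (by simp) (by simp)]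
  obtain _ | n := n
  · have : @Mono C _ P₁ P₀ ((twoTermComplex d).d 1 0) := by
      rw [twoTermComplex_d]
      infer_instance
    exact (ShortComplex.exact_iff_mono ((twoTermComplex d).sc' 2 1 0)
      ((isZero_twoTermComplex_X d 0).eq_of_src _ _)).2 this
  · exact ShortComplex.exact_of_isZero_X₂ _ (isZero_twoTermComplex_X d n)

/-- A short exact sequence `0 ⟶ P₁ ⟶ P₀ ⟶ M ⟶ 0` with `P₁` and `P₀` projective, as a
projective resolution of `M`. -/
noncomputable def CategoryTheory.ShortComplex.ShortExact.projectiveResolution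
    {S : ShortComplex C} (hS : S.ShortExact) (h₁ : Projective S.X₁) (h₂ : Projective S.X₂) :
    ProjectiveResolution S.X₃ where
  complex := twoTermComplex S.f
  projective n := by
    obtain _ | _ | n := n
    · exact h₂
    · exact h₁
    · exact (isZero_twoTermComplex_X S.f n).projective
  π := (ChainComplex.toSingle₀Equiv _ _).symm ⟨S.g,
    (congrArg (· ≫ S.g) (twoTermComplex_d S.f)).trans S.zero⟩
  quasiIso := ⟨fun n => by
    have := hS.mono_f
    obtain _ | n := n
    · rw [ChainComplex.quasiIsoAt₀_iff, ShortComplex.quasiIso_iff_of_zeros']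
      · refine (ShortComplex.exact_and_epi_g_iff_of_iso (S₂ := S) ?_).2 ⟨hS.exact, hS.epi_g⟩
        refine ShortComplex.isoMk (Iso.refl S.X₁) (Iso.refl S.X₂) (Iso.refl S.X₃) ?_ ?_
        · exact ((Category.id_comp S.f).trans (twoTermComplex_d S.f).symm).trans
            (Category.comp_id _).symm
        · exact ((Category.id_comp S.g).trans (ChainComplex.toSingle₀Equiv_symm_apply_f_zero
            (C := twoTermComplex S.f) (X := S.X₃) S.g
            ((congrArg (· ≫ S.g) (twoTermComplex_d S.f)).trans S.zero)).symm).trans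
              (Category.comp_id _).symm
      all_goals rfl
    · rw [quasiIsoAt_iff_exactAt']
      · exact twoTermComplex_exactAt_succ _ _
      · exact ChainComplex.exactAt_succ_single_obj _ _⟩

end Resolution

section ProjectiveDimension

variable {R : Type} [CommRing R]

lemma hasProjectiveDimensionLT_two_of_pd_le_one {M : ModuleCat R} (h : pd M ≤ 1) :
    HasProjectiveDimensionLT M 2 := by
  have hne : {n : ℕ∞ | ∃ k : ℕ, (k : ℕ∞) = n ∧ pdLE M k}.Nonempty := by
    by_contra hne
    rw [Set.not_nonempty_iff_eq_empty] at hne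
    simp [pd, hne] at h
  obtain ⟨k, hk, P, hP⟩ := csInf_mem hne
  have hk1 : k ≤ 1 := by
    rw [pd, ← hk] at h
    exact_mod_cast h
  have hmono : Mono (P.complex.d 1 0) := by
    refine (ShortComplex.exact_iff_mono _ ?_).1 (P.exact_succ 0)
    exact (hP 2 (by lia)).eq_of_src _ _
  let S := ShortComplex.mk _ _ P.complex_d_comp_π_f_zero
  have hS : S.ShortExact :=
    { exact := ShortComplex.exact_of_g_is_cokernel _ P.isColimitCokernelCofork
      mono_f := hmono
      epi_g := inferInstanceAs (Epi (P.π.f 0)) }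
  have h₁ : Projective S.X₁ := P.projective 1
  have h₂ : Projective S.X₂ := P.projective 0
  exact (hS.hasProjectiveDimensionLT_X₃_iff 0 h₂).2 inferInstance

lemma pd_le_one_of_hasProjectiveDimensionLT_two {M : ModuleCat R}
    (h : HasProjectiveDimensionLT M 2) : pd M ≤ 1 := by
  have hS := ModuleCat.shortExact_projectiveShortComplex M
  have h₂ : Projective M.projectiveShortComplex.X₂ :=
    (IsProjective.iff_projective _).1 inferInstance
  have h₁ : Projective M.projectiveShortComplex.X₁ :=
    projective_iff_hasProjectiveDimensionLT_one.2 ((hS.hasProjectiveDimensionLT_X₃_iff 0 h₂).1 h)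
  refine sInf_le ⟨1, rfl, hS.projectiveResolution h₁ h₂, fun i hi => ?_⟩
  obtain ⟨n, rfl⟩ := Nat.exists_eq_add_of_le' hi
  exact isZero_twoTermComplex_X _ n

lemma hasProjectiveDimensionLT_two_of_exact {D D' : Type} [AddCommGroup D] [AddCommGroup D']
    [Module R D] [Module R D'] (f : R →ₗ[R] R × D) (g : R × D →ₗ[R] D')
    (hfg : Function.Exact f g) (hf : Function.Injective f) (hg : Function.Surjective g)
    (h : HasProjectiveDimensionLT (ModuleCat.of R D) 2) :
    HasProjectiveDimensionLT (ModuleCat.of R D') 2 := by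
  have hS := ModuleCat.shortComplex_shortExact
    (ModuleCat.shortComplexOfCompEqZero f g hfg.linearMap_comp_eq_zero) hfg hf hg
  have : Projective (ModuleCat.of R R) := (IsProjective.iff_projective _).1 inferInstance
  have h₁ : HasProjectiveDimensionLT (ModuleCat.of R R) 1 := inferInstance
  have h₁' : HasProjectiveDimensionLT (ModuleCat.of R R) 2 :=
    hasProjectiveDimensionLT_of_ge _ 1 2 (by lia)
  have h₂ : HasProjectiveDimensionLT (ModuleCat.of R (R × D)) 2 :=
    hasProjectiveDimensionLT_of_iso
      (ModuleCat.biprodIsoProd (ModuleCat.of R R) (ModuleCat.of R D)) 2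
  exact hS.hasProjectiveDimensionLT_X₃ 1 h₁ h₂

end ProjectiveDimension

section Ext

open Abelian

variable {R : Type} [CommRing R]

lemma Ext.smul_eq_zero_of_comp_eq_smul {D Z N : ModuleCat.{0} R} (f : R) (a : Z ⟶ D) (b : D ⟶ Z)
    (hab : a ≫ b = f • 𝟙 Z) (i : ℕ) [HasProjectiveDimensionLT D i] (x : Ext Z N i) :
    f • x = 0 := by
  have hx : (Ext.mk₀ (a ≫ b)).comp x (zero_add i) = f • x := by
    rw [hab, Ext.mk₀_smul, Ext.smul_comp, Ext.mk₀_id_comp]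
  rw [← hx, ← Ext.mk₀_comp_mk₀, Ext.comp_assoc_of_second_deg_zero,
    Ext.eq_zero_of_hasProjectiveDimensionLT ((Ext.mk₀ b).comp x (zero_add i)) i le_rfl,
    Ext.comp_zero]

lemma Ext.smul_eq_zero_of_shortExact_of_projective {S : ShortComplex (ModuleCat.{0} R)}
    (hS : S.ShortExact) (h₂ : Projective S.X₂) {N : ModuleCat.{0} R} (f : R) {i : ℕ}
    (h : ∀ x : Ext S.X₁ N i, f • x = 0) (x : Ext S.X₃ N (i + 1)) : f • x = 0 := by
  obtain ⟨x, rfl⟩ := precomp_extClass_surjective_of_projective_X₂ N hS i x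
  change f • hS.extClass.comp x (add_comm 1 i) = 0
  rw [← Ext.comp_smul, h, Ext.comp_zero]

lemma Ext.smul_eq_zero_of_smul_eq_zero {M N : ModuleCat.{0} R} (y : R) (hy : ∀ z : N, y • z = 0)
    {i : ℕ} (x : Ext M N i) : y • x = 0 := by
  have : y • 𝟙 N = 0 := by
    ext z
    exact hy z
  rw [Ext.smul_eq_comp_mk₀, this, Ext.mk₀_zero, Ext.comp_zero]

/-- If `l : F → R` is a linear form on a projective module, then `Ext (ker l) N i` surjects onto
`Ext (R ⧸ range l) N (i + 2)`; here only the resulting comparison of annihilators is recorded. -/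
lemma Ext.smul_eq_zero_of_ker {F : Type} [AddCommGroup F] [Module R F] [Module.Projective R F]
    (l : F →ₗ[R] R) {I : Ideal R} (hI : LinearMap.range l = I) {N : ModuleCat.{0} R} (f : R) {i : ℕ}
    (h : ∀ x : Ext (ModuleCat.of R (LinearMap.ker l)) N i, f • x = 0)
    (x : Ext (ModuleCat.of R (R ⧸ I)) N (i + 2)) : f • x = 0 := by
  subst hI
  let S₁ : ShortComplex (ModuleCat.{0} R) :=
    ModuleCat.shortComplexOfCompEqZero (LinearMap.ker l).subtype l.rangeRestrict
      (LinearMap.ext fun z => Subtype.ext z.2)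
  let S₂ : ShortComplex (ModuleCat.{0} R) :=
    ModuleCat.shortComplexOfCompEqZero (LinearMap.range l).subtype (LinearMap.range l).mkQ
      (LinearMap.ext fun z => (Submodule.Quotient.mk_eq_zero _).2 z.2)
  have hS₁ : S₁.ShortExact := ModuleCat.shortComplex_shortExact S₁
    (LinearMap.exact_iff.2 (by simp [S₁])) (Submodule.subtype_injective _)
    l.surjective_rangeRestrict
  have hS₂ : S₂.ShortExact := ModuleCat.shortComplex_shortExact S₂
    (LinearMap.exact_subtype_mkQ _) (Submodule.subtype_injective _) (Submodule.mkQ_surjective _)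
  have hF : Projective S₁.X₂ := (IsProjective.iff_projective F).1 inferInstance
  have hR : Projective S₂.X₂ := (IsProjective.iff_projective R).1 inferInstance
  exact Ext.smul_eq_zero_of_shortExact_of_projective hS₂ hR f
    (Ext.smul_eq_zero_of_shortExact_of_projective hS₁ hF f h) x

/-- The ideal generated by the first `r` terms of the sequence `y`. -/
def initialIdeal (y : ℕ → R) (r : ℕ) : Ideal R := Ideal.span (y '' Set.Iio r)

lemma initialIdeal_succ (y : ℕ → R) (r : ℕ) :
    initialIdeal y (r + 1) = initialIdeal y r ⊔ Ideal.span {y r} := by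
  rw [initialIdeal, initialIdeal, ← Ideal.span_union]
  congr 1
  ext z
  simp only [Set.mem_image, Set.mem_Iio, Set.mem_union, Set.mem_singleton_iff,
    Nat.lt_succ_iff_lt_or_eq]
  grind

lemma mem_initialIdeal (y : ℕ → R) {t r : ℕ} (h : t < r) : y t ∈ initialIdeal y r :=
  Ideal.subset_span ⟨t, h, rfl⟩

lemma Ext.smul_eq_zero_of_initialIdeal_succ (y : ℕ → R) (r : ℕ)
    (hreg : IsSMulRegular (R ⧸ initialIdeal y r) (y r)) {N : ModuleCat.{0} R}
    (hy : ∀ z : N, y r • z = 0) (f : R) {i : ℕ}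
    (h : ∀ x : Ext (ModuleCat.of R (R ⧸ initialIdeal y (r + 1))) N (i + 1), f • x = 0)
    (x : Ext (ModuleCat.of R (R ⧸ initialIdeal y r)) N i) : f • x = 0 := by
  have hle : initialIdeal y r ≤ initialIdeal y (r + 1) :=
    (initialIdeal_succ y r).symm ▸ le_sup_left
  let S : ShortComplex (ModuleCat.{0} R) := ShortComplex.mk
    (y r • 𝟙 (ModuleCat.of R (R ⧸ initialIdeal y r)))
    (ModuleCat.ofHom (Submodule.factor hle)) (ModuleCat.hom_ext (LinearMap.ext fun z => by
      obtain ⟨z, rfl⟩ := Submodule.Quotient.mk_surjective _ z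
      exact (Submodule.Quotient.mk_eq_zero _).2
        (Ideal.mul_mem_right z _ (mem_initialIdeal y r.lt_succ_self))))
  have hS : S.ShortExact :=
    { exact := by
        rw [ShortComplex.ShortExact.moduleCat_exact_iff_function_exact]
        intro z
        obtain ⟨z, rfl⟩ := Submodule.Quotient.mk_surjective _ z
        refine (Submodule.Quotient.mk_eq_zero (initialIdeal y (r + 1))).trans ⟨fun hz => ?_, ?_⟩
        · rw [initialIdeal_succ, Submodule.mem_sup] at hz
          obtain ⟨u, hu, v, hv, rfl⟩ := hz
          obtain ⟨w, rfl⟩ := Ideal.mem_span_singleton'.1 hv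
          refine ⟨Submodule.Quotient.mk w, (Submodule.Quotient.eq _).2 ?_⟩
          have : y r * w - (u + w * y r) = -u := by ring
          change y r * w - (u + w * y r) ∈ _
          rw [this]
          exact neg_mem hu
        · rintro ⟨w, hw⟩
          obtain ⟨w, rfl⟩ := Submodule.Quotient.mk_surjective _ w
          have hw := hle ((Submodule.Quotient.eq _).1 hw)
          have hyr : y r * w ∈ initialIdeal y (r + 1) :=
            Ideal.mul_mem_right w _ (mem_initialIdeal y r.lt_succ_self)
          exact (Submodule.sub_mem_iff_right _ hyr).1 hw
      mono_f := (ModuleCat.mono_iff_injective _).2 hreg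
      epi_g := (ModuleCat.epi_iff_surjective _).2 (Submodule.factor_surjective hle) }
  obtain ⟨x₂, hx₂⟩ := Ext.contravariant_sequence_exact₁ hS N (f • x) (add_comm 1 i)
    (by rw [Ext.comp_smul, h])
  rw [← hx₂]
  change (Ext.mk₀ (y r • 𝟙 _)).comp _ _ = 0
  rw [Ext.mk₀_smul, Ext.smul_comp, Ext.smul_eq_zero_of_smul_eq_zero (y r) hy]

lemma smul_eq_zero_of_ext_quotient_initialIdeal (y : ℕ → R) (n : ℕ)
    (hreg : ∀ r < n, IsSMulRegular (R ⧸ initialIdeal y r) (y r)) {N : ModuleCat.{0} R}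
    (hy : ∀ r < n, ∀ z : N, y r • z = 0) (f : R)
    (h : ∀ x : Ext (ModuleCat.of R (R ⧸ initialIdeal y n)) N n, f • x = 0) (z : N) :
    f • z = 0 := by
  induction n with
  | zero =>
    have hz : ∀ u ∈ initialIdeal y 0, u • z = 0 := by
      intro u hu
      have : u = 0 := by simpa [initialIdeal] using hu
      rw [this, zero_smul]
    let g : (R ⧸ initialIdeal y 0) →ₗ[R] N :=
      (initialIdeal y 0).liftQ (LinearMap.toSpanSingleton R N z) hz
    have hg := h (Ext.mk₀ (ModuleCat.ofHom g))
    rw [← Ext.mk₀_smul, Ext.mk₀_eq_zero_iff] at hg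
    have := congrArg (fun φ => φ.hom (Submodule.Quotient.mk 1)) hg
    change f • ((1 : R) • z) = 0 at this
    rwa [one_smul] at this
  | succ n ih =>
    refine ih (fun r hr => hreg r (by lia)) (fun r hr => hy r (by lia)) fun x => ?_
    exact Ext.smul_eq_zero_of_initialIdeal_succ y n (hreg n (by lia)) (hy n (by lia)) f h x

/-- Let `y 0, …, y (n - 1)` be a regular sequence with `4 ≤ n`. If multiplication by `f`
on its first syzygy module factors through a module of projective dimension at most one, then `f`
lies in the ideal generated by the sequence. -/
theorem mem_initialIdeal_of_syzygy_factor (y : ℕ → R) (n : ℕ) (hn : 4 ≤ n)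
    (hreg : ∀ r < n, IsSMulRegular (R ⧸ initialIdeal y r) (y r))
    {D : Type} [AddCommGroup D] [Module R D] (hD : HasProjectiveDimensionLT (ModuleCat.of R D) 2)
    (f : R)
    (a : LinearMap.ker (Fintype.linearCombination R (fun t : Fin n => y t)) →ₗ[R] D)
    (b : D →ₗ[R] LinearMap.ker (Fintype.linearCombination R (fun t : Fin n => y t)))
    (hab : ∀ z, b (a z) = f • z) : f ∈ initialIdeal y n := by
  have hrange : LinearMap.range (Fintype.linearCombination R (fun t : Fin n => y t)) =
      initialIdeal y n := by
    rw [Fintype.range_linearCombination, initialIdeal]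
    congr 1
    ext z
    constructor
    · rintro ⟨t, rfl⟩
      exact ⟨t, t.2, rfl⟩
    · rintro ⟨t, ht, rfl⟩
      exact ⟨⟨t, ht⟩, rfl⟩
  obtain ⟨i, rfl⟩ := Nat.exists_eq_add_of_le' (show 2 ≤ n by lia)
  have : HasProjectiveDimensionLT (ModuleCat.of R D) i :=
    hasProjectiveDimensionLT_of_ge _ 2 i (by lia)
  have key := smul_eq_zero_of_ext_quotient_initialIdeal y (i + 2) hreg
    (N := ModuleCat.of R (R ⧸ initialIdeal y (i + 2))) (fun r hr z => by
      obtain ⟨z, rfl⟩ := Submodule.Quotient.mk_surjective _ z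
      exact (Submodule.Quotient.mk_eq_zero _).2 (Ideal.mul_mem_right z _ (mem_initialIdeal y hr)))
    f (Ext.smul_eq_zero_of_ker _ hrange f
      (Ext.smul_eq_zero_of_comp_eq_smul f (ModuleCat.ofHom a) (ModuleCat.ofHom b)
        (by ext z : 2; exact hab z) i))
    (Submodule.Quotient.mk 1)
  simpa using (Submodule.Quotient.mk_eq_zero (initialIdeal y (i + 2)) (x := f • 1)).1 key

end Ext

section Cycle

open scoped Classical in
/-- The vertex map contracting `v 0, …, v r` to the single vertex `v 0`. -/
noncomputable def contract {ℓ : ℕ} (v : ℕ → Fin ℓ) (r : ℕ) (w : Fin ℓ) : Fin ℓ :=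
  if w ∈ v '' Set.Iic r then v 0 else w

lemma contract_of_le {ℓ : ℕ} (v : ℕ → Fin ℓ) {r s : ℕ} (h : s ≤ r) :
    contract v r (v s) = v 0 :=
  if_pos ⟨s, h, rfl⟩

lemma contract_of_notMem {ℓ : ℕ} (v : ℕ → Fin ℓ) {r : ℕ} {w : Fin ℓ} (h : w ∉ v '' Set.Iic r) :
    contract v r w = w :=
  if_neg h

/-- The difference of consecutive variables along the vertex sequence `v`. -/
noncomputable def stepForm {ℓ : ℕ} (v : ℕ → Fin ℓ) (t : ℕ) : Spoly ℓ := X (v t) - X (v (t + 1))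

lemma X_sub_X_mem_initialIdeal {ℓ : ℕ} (v : ℕ → Fin ℓ) {r s : ℕ} (h : s ≤ r) :
    (X (v 0) - X (v s) : Spoly ℓ) ∈ initialIdeal (stepForm v) r := by
  induction s with
  | zero => simp
  | succ s ih =>
    have := add_mem (ih (by lia)) (mem_initialIdeal (stepForm v) (show s < r by lia))
    simpa [stepForm] using this

lemma mem_initialIdeal_stepForm_iff {ℓ : ℕ} (v : ℕ → Fin ℓ) (r : ℕ) (p : Spoly ℓ) :
    p ∈ initialIdeal (stepForm v) r ↔ rename (contract v r) p = 0 := by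
  constructor
  · suffices h : initialIdeal (stepForm v) r ≤ RingHom.ker (rename (R := ℚ) (contract v r)) from
      fun hp => h hp
    rw [initialIdeal, Ideal.span_le]
    rintro _ ⟨t, ht : t < r, rfl⟩
    simp [stepForm, RingHom.mem_ker, contract_of_le v ht.le,
      contract_of_le v (Nat.succ_le_of_lt ht)]
  · intro hp
    have hq : (Ideal.Quotient.mkₐ ℚ (initialIdeal (stepForm v) r)).comp
        (rename (contract v r)) = Ideal.Quotient.mkₐ ℚ (initialIdeal (stepForm v) r) := by
      refine MvPolynomial.algHom_ext fun w => ?_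
      simp only [AlgHom.comp_apply, rename_X, Ideal.Quotient.mkₐ_eq_mk]
      refine Ideal.Quotient.eq.2 ?_
      by_cases hw : w ∈ v '' Set.Iic r
      · obtain ⟨s, hs, rfl⟩ := hw
        rw [contract_of_le v hs]
        exact X_sub_X_mem_initialIdeal v hs
      · simp [contract_of_notMem v hw]
    have := DFunLike.congr_fun hq p
    rw [AlgHom.comp_apply, hp, map_zero] at this
    exact Ideal.Quotient.eq_zero_iff_mem.1 this.symm

lemma isSMulRegular_stepForm {ℓ : ℕ} (v : ℕ → Fin ℓ) {n : ℕ} (hv : Set.InjOn v (Set.Iic n))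
    {r : ℕ} (hr : r < n) :
    IsSMulRegular (Spoly ℓ ⧸ initialIdeal (stepForm v) r) (stepForm v r) := by
  rw [isSMulRegular_iff_right_eq_zero_of_smul]
  intro p hp
  obtain ⟨p, rfl⟩ := Submodule.Quotient.mk_surjective _ p
  have hp : stepForm v r * p ∈ initialIdeal (stepForm v) r :=
    (Submodule.Quotient.mk_eq_zero _).1 hp
  refine (Submodule.Quotient.mk_eq_zero _).2 ?_
  rw [mem_initialIdeal_stepForm_iff] at hp ⊢
  have hr' : v (r + 1) ∉ v '' Set.Iic r := by
    rintro ⟨s, hs : s ≤ r, h⟩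
    have := hv (show s ≤ n by lia) (show r + 1 ≤ n by lia) h
    lia
  rw [map_mul, stepForm, map_sub, rename_X, rename_X, contract_of_le v le_rfl,
    contract_of_notMem v hr', mul_eq_zero] at hp
  refine hp.resolve_left (sub_ne_zero.2 fun h => hr' ?_)
  rw [← X_injective h]
  exact ⟨0, Nat.zero_le r, rfl⟩

open scoped Classical in
/-- The product of all linear forms `x_w - x_{v s}` with `s ≤ n` and `w` outside the sequence. -/
noncomputable def outerProduct {ℓ : ℕ} (v : ℕ → Fin ℓ) (n : ℕ) : Spoly ℓ :=
  ∏ w with w ∉ v '' Set.Iic n, ∏ s ∈ Finset.range (n + 1), (X w - X (v s))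

lemma X_sub_X_dvd_outerProduct {ℓ : ℕ} (v : ℕ → Fin ℓ) {n s : ℕ} (hs : s ≤ n) {w : Fin ℓ}
    (hw : w ∉ v '' Set.Iic n) : (X w - X (v s) : Spoly ℓ) ∣ outerProduct v n := by
  classical
  refine (Finset.dvd_prod_of_mem (fun s => (X w - X (v s) : Spoly ℓ))
    (Finset.mem_range.2 (Nat.lt_succ_of_le hs))).trans ?_
  exact Finset.dvd_prod_of_mem
    (fun w => ∏ s ∈ Finset.range (n + 1), (X w - X (v s) : Spoly ℓ)) (by simpa using hw)

lemma outerProduct_notMem_initialIdeal {ℓ : ℕ} (v : ℕ → Fin ℓ) (n : ℕ) :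
    outerProduct v n ∉ initialIdeal (stepForm v) n := by
  classical
  rw [mem_initialIdeal_stepForm_iff, outerProduct, map_prod, Finset.prod_eq_zero_iff]
  rintro ⟨w, hw, h⟩
  rw [map_prod, Finset.prod_eq_zero_iff] at h
  obtain ⟨s, hs, h⟩ := h
  rw [Finset.mem_range_succ_iff] at hs
  have hw : w ∉ v '' Set.Iic n := by simpa using hw
  rw [map_sub, rename_X, rename_X, contract_of_le v hs, contract_of_notMem v hw,
    sub_eq_zero] at h
  exact hw ⟨0, Nat.zero_le n, (X_injective h).symm⟩

lemma exists_linearMap_eq_mul_of_dvd {R M : Type*} [CommRing R] [IsDomain R] [AddCommGroup M]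
    [Module R M] (g : M →ₗ[R] R) {α : R} (hα : α ≠ 0) (h : ∀ m, α ∣ g m) :
    ∃ q : M →ₗ[R] R, ∀ m, g m = α * q m := by
  choose q hq using h
  refine ⟨⟨⟨q, fun m m' => mul_left_cancel₀ hα ?_⟩, fun r m => mul_left_cancel₀ hα ?_⟩, hq⟩
  · rw [mul_add, ← hq, ← hq, ← hq, map_add]
  · simp only [smul_eq_mul, RingHom.id_apply]
    rw [← hq, map_smul, smul_eq_mul, hq, mul_left_comm]

/-- The sequence `v 0, …, v n` is, in this cyclic order, an induced cycle of `G`. -/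
def IsInducedCycle {V : Type*} (G : SimpleGraph V) (v : ℕ → V) (n : ℕ) : Prop :=
  Set.InjOn v (Set.Iic n) ∧
    ∀ s t, s < t → t ≤ n → (G.Adj (v s) (v t) ↔ t = s + 1 ∨ s = 0 ∧ t = n)

/-- The module of syzygies of the forms `stepForm v 0, …, stepForm v (n - 1)`. -/
noncomputable abbrev stepSyzygy {ℓ : ℕ} (v : ℕ → Fin ℓ) (n : ℕ) :
    Submodule (Spoly ℓ) (Fin n → Spoly ℓ) :=
  LinearMap.ker (Fintype.linearCombination (Spoly ℓ) (fun t : Fin n => stepForm v t))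

/-- The difference `θ(x_i) - θ(x_j)` as a linear function of the derivation `θ`. -/
noncomputable def derivDiff {ℓ : ℕ} (i j : Fin ℓ) :
    Derivation ℚ (Spoly ℓ) (Spoly ℓ) →ₗ[Spoly ℓ] Spoly ℓ where
  toFun θ := θ (X i) - θ (X j)
  map_add' θ θ' := by simp only [Derivation.add_apply]; ring
  map_smul' c θ := by simp only [Derivation.smul_apply, smul_eq_mul, RingHom.id_apply]; ring

lemma exists_derivation_of_syzygy {ℓ : ℕ} (G : SimpleGraph (Fin ℓ)) {v : ℕ → Fin ℓ} {n : ℕ}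
    (hv : IsInducedCycle G v n) :
    ∃ a : stepSyzygy v n →ₗ[Spoly ℓ] logDer ℓ G,
      (∀ h, derivDiff (v n) (v 0) (a h) = 0) ∧
      ∀ h (t : Fin n), derivDiff (v t) (v (t + 1)) (a h) =
        stepForm v t * (outerProduct v n * h.1 t) := by
  classical
  let δ : Fin n → Derivation ℚ (Spoly ℓ) (Spoly ℓ) := fun t => mkDerivation ℚ fun w =>
    if w ∈ v '' Set.Ioc t.1 n then - (outerProduct v n * stepForm v t) else 0
  let A := Fintype.linearCombination (Spoly ℓ) δ
  have hA (h : Fin n → Spoly ℓ) (w : Fin ℓ) : A h (X w) = ∑ t : Fin n,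
      if w ∈ v '' Set.Ioc t.1 n then - (outerProduct v n * (stepForm v t * h t)) else 0 := by
    change Derivation.coeFnAddMonoidHom (Fintype.linearCombination (Spoly ℓ) δ h) (X w) = _
    rw [Fintype.linearCombination_apply, map_sum, Finset.sum_apply]
    refine Finset.sum_congr rfl fun t _ => ?_
    change (h t • δ t) (X w) = _
    rw [Derivation.smul_apply, mkDerivation_X, smul_eq_mul]
    split_ifs <;> ring
  have hmem {s : ℕ} (hs : s ≤ n) (t : Fin n) : v s ∈ v '' Set.Ioc t.1 n ↔ t.1 < s := by
    refine ⟨?_, fun h => ⟨s, ⟨h, hs⟩, rfl⟩⟩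
    rintro ⟨s', ⟨h, hs'⟩, hss'⟩
    rwa [← hv.1 hs' hs hss']
  have hA_out (h : Fin n → Spoly ℓ) {w : Fin ℓ} (hw : w ∉ v '' Set.Iic n) : A h (X w) = 0 := by
    rw [hA]
    refine Finset.sum_eq_zero fun t _ => if_neg ?_
    rintro ⟨s, hs, rfl⟩
    exact hw ⟨s, hs.2, rfl⟩
  have hA_zero (h : Fin n → Spoly ℓ) : A h (X (v 0)) = 0 := by
    rw [hA]
    exact Finset.sum_eq_zero fun t _ => if_neg (by simp [hmem (Nat.zero_le n)])
  have hA_last (h : stepSyzygy v n) : A h (X (v n)) = 0 := by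
    rw [hA]
    have hh := LinearMap.mem_ker.1 h.2
    rw [Fintype.linearCombination_apply] at hh
    simp only [hmem le_rfl, Fin.is_lt, if_true, Finset.sum_neg_distrib, ← Finset.mul_sum]
    simp only [smul_eq_mul, mul_comm] at hh
    simp only [mul_comm (stepForm v _)]
    simp [mul_comm, hh]
  have hA_dvd (h : Fin n → Spoly ℓ) (w : Fin ℓ) : outerProduct v n ∣ A h (X w) := by
    rw [hA]
    refine Finset.dvd_sum fun t _ => ?_
    split_ifs
    · exact (Dvd.intro _ rfl).neg_right
    · exact dvd_zero _
  have hA_step (h : Fin n → Spoly ℓ) (t : Fin n) : A h (X (v t)) - A h (X (v (t + 1))) =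
      stepForm v t * (outerProduct v n * h t) := by
    rw [hA, hA, ← Finset.sum_sub_distrib, Finset.sum_eq_single t]
    · rw [if_neg (by simp [hmem t.2.le]), if_pos ((hmem t.2 t).2 (by lia))]
      ring
    · intro t' _ ht'
      have : t'.1 ≠ t.1 := fun h => ht' (Fin.ext h)
      simp only [hmem t.2.le, hmem (Nat.succ_le_of_lt t.2)]
      simp only [show t'.1 < t.1.succ ↔ t'.1 < t.1 by lia, sub_self]
    · simp
  have hA_lt (h : stepSyzygy v n) {s t : ℕ} (hst : s < t) (ht : t ≤ n)
      (hadj : G.Adj (v s) (v t)) :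
      (X (v s) - X (v t)) ∣ A h (X (v s)) - A h (X (v t)) := by
    obtain rfl | ⟨rfl, rfl⟩ := (hv.2 s t hst ht).1 hadj
    · exact (hA_step h ⟨s, ht⟩) ▸ Dvd.intro _ rfl
    · rw [hA_zero, hA_last, sub_zero]
      exact dvd_zero _
  have hA_mem (h : stepSyzygy v n) : A h ∈ logDer ℓ G := by
    intro i j hij
    by_cases hi : i ∈ v '' Set.Iic n <;> by_cases hj : j ∈ v '' Set.Iic n
    · obtain ⟨s, hs, rfl⟩ := hi
      obtain ⟨t, ht, rfl⟩ := hj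
      obtain hst | rfl | hst := lt_trichotomy s t
      · exact hA_lt h hst ht hij
      · exact absurd rfl hij.ne
      · rw [← neg_sub (X (v t)), ← neg_sub (A h (X (v t)))]
        exact (neg_dvd.2 (hA_lt h hst hs hij.symm)).neg_right
    · obtain ⟨s, hs, rfl⟩ := hi
      rw [hA_out h hj, sub_zero, ← neg_sub, neg_dvd]
      exact (X_sub_X_dvd_outerProduct v hs hj).trans (hA_dvd h _)
    · obtain ⟨s, hs, rfl⟩ := hj
      rw [hA_out h hi, zero_sub, dvd_neg]
      exact (X_sub_X_dvd_outerProduct v hs hi).trans (hA_dvd h _)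
    · rw [hA_out h hi, hA_out h hj, sub_zero]
      exact dvd_zero _
  refine ⟨(A.comp (stepSyzygy v n).subtype).codRestrict _ hA_mem, fun h => ?_, fun h t => ?_⟩
  · change A h (X (v n)) - A h (X (v 0)) = 0
    rw [hA_zero, hA_last, sub_zero]
  · exact hA_step h t

/-- An induced cycle with at least five vertices forces the projective dimension of the module of
logarithmic derivations to be at least two. -/
theorem not_hasProjectiveDimensionLT_two_of_isInducedCycle {ℓ : ℕ} (G : SimpleGraph (Fin ℓ))
    {v : ℕ → Fin ℓ} {n : ℕ} (hn : 4 ≤ n) (hv : IsInducedCycle G v n) :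
    ¬ HasProjectiveDimensionLT (ModuleCat.of (Spoly ℓ) (logDer ℓ G)) 2 := by
  intro hD
  have hne {s t : ℕ} (hst : s < t) (ht : t ≤ n) : (X (v s) - X (v t) : Spoly ℓ) ≠ 0 := by
    refine sub_ne_zero.2 fun h => ?_
    exact hst.ne (hv.1 (show s ≤ n by lia) ht (X_injective h))
  have hstep (t : Fin n) : stepForm v t ≠ 0 := hne (Nat.lt_succ_self t) t.2
  have hlast : (X (v n) - X (v 0) : Spoly ℓ) ≠ 0 := by
    rw [← neg_sub]
    exact neg_ne_zero.2 (hne (by lia) le_rfl)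
  obtain ⟨a, ha_last, ha_step⟩ := exists_derivation_of_syzygy G hv
  have hq (t : Fin n) :=
    exists_linearMap_eq_mul_of_dvd (R := Spoly ℓ) (M := logDer ℓ G)
      ((derivDiff (v t) (v (t + 1))).comp (logDer ℓ G).subtype) (hstep t)
        fun θ => θ.2 _ _ ((hv.2 t (t + 1) (Nat.lt_succ_self t) t.2).2 (Or.inl rfl))
  choose q hq using hq
  obtain ⟨q', hq'⟩ := exists_linearMap_eq_mul_of_dvd (R := Spoly ℓ) (M := logDer ℓ G)
    ((derivDiff (v n) (v 0)).comp (logDer ℓ G).subtype)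
      hlast fun θ => θ.2 _ _ ((hv.2 0 n (by lia) le_rfl).2 (Or.inr ⟨rfl, rfl⟩)).symm
  have hb (θ : logDer ℓ G) : LinearMap.pi (fun t => q t - q') θ ∈ stepSyzygy v n := by
    rw [LinearMap.mem_ker, Fintype.linearCombination_apply]
    have h₁ : ∑ t : Fin n, stepForm v t * q t θ = θ.1 (X (v 0)) - θ.1 (X (v n)) := by
      rw [← Finset.sum_range_sub' (fun t => θ.1 (X (v t))), ← Fin.sum_univ_eq_sum_range
        (fun t => θ.1 (X (v t)) - θ.1 (X (v (t + 1))))]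
      exact Finset.sum_congr rfl fun t _ => (hq t θ).symm
    have h₂ : ∑ t : Fin n, stepForm v t = X (v 0) - X (v n) := by
      rw [Fin.sum_univ_eq_sum_range (stepForm v)]
      exact Finset.sum_range_sub' (fun t => (X (v t) : Spoly ℓ)) n
    have h₃ : θ.1 (X (v n)) - θ.1 (X (v 0)) = (X (v n) - X (v 0)) * q' θ := hq' θ
    calc ∑ t : Fin n, (q t θ - q' θ) * stepForm v t
        = ∑ t : Fin n, stepForm v t * q t θ - (∑ t : Fin n, stepForm v t) * q' θ := by
          rw [Finset.sum_mul, ← Finset.sum_sub_distrib]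
          exact Finset.sum_congr rfl fun t _ => by ring
      _ = 0 := by
          rw [h₁, h₂]
          linear_combination - h₃
  refine outerProduct_notMem_initialIdeal v n (mem_initialIdeal_of_syzygy_factor (stepForm v) n hn
    (fun r hr => isSMulRegular_stepForm v hv.1 hr) hD _ a
    ((LinearMap.pi fun t => q t - q').codRestrict _ hb) fun h => ?_)
  refine Subtype.ext (funext fun t => ?_)
  have h₁ : q t (a h) = outerProduct v n * h.1 t :=
    mul_left_cancel₀ (hstep t) ((hq t (a h)).symm.trans (ha_step h t))
  have h₂ : q' (a h) = 0 :=
    (mul_eq_zero.1 ((hq' (a h)).symm.trans (ha_last h))).resolve_left hlast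
  change q t (a h) - q' (a h) = outerProduct v n * h.1 t
  rw [h₁, h₂, sub_zero]

end Cycle

section EdgeDeletion

/-- The graph obtained from `G` by deleting the edge `s(i, j)` and isolating all common neighbours
of `i` and `j`. -/
def avoidGraph {V : Type*} (G : SimpleGraph V) (i j : V) : SimpleGraph V where
  Adj a b := (G.deleteEdges {s(i, j)}).Adj a b ∧
    a ∉ G.commonNeighbors i j ∧ b ∉ G.commonNeighbors i j
  symm := ⟨fun _ _ h => ⟨h.1.symm, h.2.2, h.2.1⟩⟩
  loopless := ⟨fun _ h => h.1.ne rfl⟩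

lemma exists_isInducedCycle_of_reachable {V : Type*} (G : SimpleGraph V) {i j : V}
    (hij : G.Adj i j) (h : (avoidGraph G i j).Reachable i j) :
    ∃ (n : ℕ) (v : ℕ → V), 3 ≤ n ∧ v 0 = i ∧ v n = j ∧ IsInducedCycle G v n := by
  obtain ⟨p, hp⟩ := h.exists_walk_length_eq_dist
  have hinj : Set.InjOn p.getVert (Set.Iic p.length) :=
    (p.isPath_of_length_eq_dist hp).getVert_injOn
  have h₀ : p.getVert 0 = i := p.getVert_zero
  have hn : p.getVert p.length = j := p.getVert_length
  have hstep {s : ℕ} (hs : s < p.length) :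
      (avoidGraph G i j).Adj (p.getVert s) (p.getVert (s + 1)) := p.adj_getVert_succ hs
  have hchord {s t : ℕ} (hst : s < t) (ht : t ≤ p.length)
      (hadj : (avoidGraph G i j).Adj (p.getVert s) (p.getVert t)) : t = s + 1 := by
    have := SimpleGraph.dist_le (((p.take s).concat hadj).append (p.drop t))
    rw [SimpleGraph.Walk.length_append, SimpleGraph.Walk.length_concat,
      SimpleGraph.Walk.take_length, SimpleGraph.Walk.drop_length, ← hp] at this
    lia
  have hpos : p.length ≠ 0 := fun h => hij.ne (h₀ ▸ h ▸ hn)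
  have hC {s : ℕ} (hs : s ≤ p.length) : p.getVert s ∉ G.commonNeighbors i j := by
    rcases hs.lt_or_eq with hs | rfl
    · exact (hstep hs).2.1
    · have := (hstep (show p.length - 1 < p.length by lia)).2.2
      rwa [Nat.sub_add_cancel (by lia)] at this
  have hadj (s t : ℕ) (hst : s < t) (ht : t ≤ p.length) :
      G.Adj (p.getVert s) (p.getVert t) ↔ t = s + 1 ∨ s = 0 ∧ t = p.length := by
    constructor
    · intro hG
      by_cases he : s(p.getVert s, p.getVert t) = s(i, j)
      · right
        rcases Sym2.eq_iff.1 he with ⟨h₁, h₂⟩ | ⟨h₁, h₂⟩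
        · exact ⟨hinj (show s ≤ p.length by lia) (Nat.zero_le _) (h₁.trans h₀.symm),
            hinj ht Set.self_mem_Iic (h₂.trans hn.symm)⟩
        · have := hinj (show s ≤ p.length by lia) Set.self_mem_Iic (h₁.trans hn.symm)
          lia
      · exact Or.inl (hchord hst ht
          ⟨SimpleGraph.deleteEdges_adj.2 ⟨hG, he⟩, hC (by lia), hC ht⟩)
    · rintro (rfl | ⟨rfl, rfl⟩)
      · exact (SimpleGraph.deleteEdges_adj.1 (hstep ht).1).1
      · rwa [h₀, hn]
  refine ⟨p.length, p.getVert, ?_, h₀, hn, hinj, hadj⟩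
  by_contra! hlt
  obtain h | h : p.length = 1 ∨ p.length = 2 := by lia
  · have := hstep (s := 0) (by lia)
    rw [h₀, zero_add, ← h, hn] at this
    exact (SimpleGraph.deleteEdges_adj.1 this.1).2 rfl
  · refine hC (s := 1) (by lia) ⟨?_, ?_⟩
    · have := (hadj 0 1 (by lia) (by lia)).2 (Or.inl rfl)
      rwa [h₀] at this
    · have := ((hadj 1 p.length (by lia) le_rfl).2 (Or.inl h)).symm
      rwa [hn] at this

lemma IsInducedCycle.nonempty_iso_cycleGraph_four {V : Type*} {G : SimpleGraph V} {v : ℕ → V}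
    (hv : IsInducedCycle G v 3) :
    Nonempty (G.induce (v '' Set.Iic 3) ≃g SimpleGraph.cycleGraph 4) := by
  let f : Fin 4 → v '' Set.Iic 3 := fun s => ⟨v s, s, Nat.le_of_lt_succ s.2, rfl⟩
  have hf : Function.Bijective f := by
    refine ⟨fun s t h => Fin.ext (hv.1 (Nat.le_of_lt_succ s.2) (Nat.le_of_lt_succ t.2)
      (congrArg Subtype.val h)), ?_⟩
    rintro ⟨_, s, hs, rfl⟩
    exact ⟨⟨s, Nat.lt_succ_of_le hs⟩, rfl⟩
  have key (s t : Fin 4) (hst : s < t) :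
      G.Adj (v s) (v t) ↔ (SimpleGraph.cycleGraph 4).Adj s t := by
    rw [hv.2 s t hst (Nat.le_of_lt_succ t.2)]
    revert s t
    decide
  refine ⟨(⟨Equiv.ofBijective f hf, fun {s t} => ?_⟩ :
    SimpleGraph.cycleGraph 4 ≃g G.induce (v '' Set.Iic 3)).symm⟩
  change G.Adj (v s) (v t) ↔ _
  rcases lt_trichotomy s t with h | rfl | h
  · exact key s t h
  · simp
  · rw [G.adj_comm, (SimpleGraph.cycleGraph 4).adj_comm]
    exact key t s h

variable {ℓ : ℕ}

lemma X_sub_X_dvd_iff (i j : Fin ℓ) (p : Spoly ℓ) :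
    (X i - X j) ∣ p ↔ rename (Function.update id j i) p = 0 := by
  let v : ℕ → Fin ℓ := fun t => if t = 0 then i else j
  have hc : contract v 1 = Function.update id j i := by
    funext w
    by_cases hw : w ∈ v '' Set.Iic 1
    · obtain ⟨s, hs, rfl⟩ := hw
      rw [contract_of_le v hs]
      by_cases h : s = 0 <;> simp [v, h, Function.update_apply]
    · rw [contract_of_notMem v hw, Function.update_of_ne, id]
      rintro rfl
      exact hw ⟨1, Set.self_mem_Iic, rfl⟩
  rw [← hc, ← mem_initialIdeal_stepForm_iff, initialIdeal_succ]
  simp [initialIdeal, stepForm, v, Ideal.mem_span_singleton]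

lemma prime_X_sub_X {i j : Fin ℓ} (hij : i ≠ j) : Prime (X i - X j : Spoly ℓ) := by
  refine ⟨sub_ne_zero.2 fun h => hij (X_injective h), fun h => ?_, fun p q h => ?_⟩
  · have := (X_sub_X_dvd_iff i j 1).1 h.dvd
    simp at this
  · simpa only [X_sub_X_dvd_iff, map_mul, mul_eq_zero] using h

lemma isRelPrime_X_sub_X {i k k' : Fin ℓ} (hk : i ≠ k) (hk' : i ≠ k') (h : k ≠ k') :
    IsRelPrime (X i - X k : Spoly ℓ) (X i - X k') := by
  rw [(prime_X_sub_X hk).irreducible.isRelPrime_iff_not_dvd, X_sub_X_dvd_iff, map_sub, rename_X,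
    rename_X, Function.update_of_ne hk, Function.update_of_ne h.symm, sub_eq_zero]
  exact fun h => hk' (X_injective h)

open scoped Classical in
/-- The product of all linear forms `x_w - x_k` with `k` in a set `C`. -/
noncomputable def prodOver (C : Set (Fin ℓ)) (w : Fin ℓ) : Spoly ℓ := ∏ k with k ∈ C, (X w - X k)

lemma X_sub_X_dvd_prodOver {C : Set (Fin ℓ)} {k : Fin ℓ} (hk : k ∈ C) (w : Fin ℓ) :
    (X w - X k : Spoly ℓ) ∣ prodOver C w := by
  classical
  exact Finset.dvd_prod_of_mem (fun k => (X w - X k : Spoly ℓ)) (by simpa using hk)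

lemma prodOver_eq_zero {C : Set (Fin ℓ)} {w : Fin ℓ} (hw : w ∈ C) : prodOver C w = 0 := by
  simpa using X_sub_X_dvd_prodOver hw w

lemma X_sub_X_dvd_prodOver_sub (C : Set (Fin ℓ)) (a b : Fin ℓ) :
    (X a - X b : Spoly ℓ) ∣ prodOver C a - prodOver C b := by
  rw [X_sub_X_dvd_iff]
  simp [prodOver, Function.update_apply]

lemma prodOver_dvd {C : Set (Fin ℓ)} {w : Fin ℓ} (hw : w ∉ C) {p : Spoly ℓ}
    (h : ∀ k ∈ C, (X w - X k) ∣ p) : prodOver C w ∣ p := by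
  classical
  have hne {k : Fin ℓ} (hk : k ∈ C) : w ≠ k := fun h => hw (h ▸ hk)
  refine Finset.prod_dvd_of_isRelPrime (fun k hk k' hk' hkk' => ?_)
    fun k hk => h k (by simpa using hk)
  exact isRelPrime_X_sub_X (hne (by simpa using hk)) (hne (by simpa using hk')) hkk'

lemma not_X_sub_X_dvd_prodOver {C : Set (Fin ℓ)} {i j : Fin ℓ} (hi : i ∉ C) (hj : j ∉ C)
    (hij : i ≠ j) : ¬ (X i - X j : Spoly ℓ) ∣ prodOver C i := by
  classical
  rw [X_sub_X_dvd_iff, prodOver, map_prod, Finset.prod_eq_zero_iff]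
  rintro ⟨k, hk, h⟩
  have hk : k ∈ C := by simpa using hk
  rw [map_sub, rename_X, rename_X, Function.update_of_ne hij, Function.update_of_ne,
    sub_eq_zero] at h
  · exact hi ((X_injective h : i = k) ▸ hk)
  · rintro rfl
    exact hj hk

lemma exists_mem_logDer_deleteEdges (G : SimpleGraph (Fin ℓ)) {i j : Fin ℓ}
    (h : ¬ (avoidGraph G i j).Reachable i j) :
    ∃ θ ∈ logDer ℓ (G.deleteEdges {s(i, j)}),
      derivDiff i j θ = prodOver (G.commonNeighbors i j) i := by
  classical
  set C := G.commonNeighbors i j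
  let θ : Derivation ℚ (Spoly ℓ) (Spoly ℓ) := mkDerivation ℚ fun w =>
    if (avoidGraph G i j).Reachable i w then prodOver C w else 0
  have hθ (w : Fin ℓ) : θ (X w) =
      if (avoidGraph G i j).Reachable i w then prodOver C w else 0 := mkDerivation_X ..
  have hcut {a b : Fin ℓ} (hab : (G.deleteEdges {s(i, j)}).Adj a b)
      (ha : (avoidGraph G i j).Reachable i a) (hb : ¬ (avoidGraph G i j).Reachable i b) :
      (X a - X b : Spoly ℓ) ∣ prodOver C a := by
    by_cases haC : a ∈ C
    · rw [prodOver_eq_zero haC]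
      exact dvd_zero _
    · by_cases hbC : b ∈ C
      · exact X_sub_X_dvd_prodOver hbC a
      · have hadj : (avoidGraph G i j).Adj a b := ⟨hab, haC, hbC⟩
        exact (hb (ha.trans hadj.reachable)).elim
  refine ⟨θ, fun a b hab => ?_, ?_⟩
  · rw [hθ, hθ]
    split_ifs with ha hb hb
    · exact X_sub_X_dvd_prodOver_sub C a b
    · simpa using hcut hab ha hb
    · rw [zero_sub, dvd_neg, ← neg_sub, neg_dvd]
      exact hcut hab.symm hb ha
    · simp
  · change θ (X i) - θ (X j) = _
    rw [hθ, hθ, if_pos (SimpleGraph.Reachable.refl i), if_neg h, sub_zero]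

lemma exists_X_sub_X_dvd_derivDiff_sub (G : SimpleGraph (Fin ℓ)) {i j : Fin ℓ}
    {η : Derivation ℚ (Spoly ℓ) (Spoly ℓ)} (hη : η ∈ logDer ℓ (G.deleteEdges {s(i, j)})) :
    ∃ c : Spoly ℓ, (X i - X j) ∣ derivDiff i j η - c * prodOver (G.commonNeighbors i j) i := by
  set f : Fin ℓ → Fin ℓ := Function.update id j i
  have hfi : f i = i := by
    simp [f, Function.update_apply]
  have hfj : f j = i := by simp [f]
  have hff : f ∘ f = f := by
    funext w
    by_cases hw : w = j
    · rw [hw, Function.comp_apply, hfj, hfi]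
    · simp [f, Function.update_of_ne hw]
  obtain ⟨c, hc⟩ : prodOver (G.commonNeighbors i j) i ∣ rename f (derivDiff i j η) := by
    refine prodOver_dvd (fun h => G.loopless.irrefl i h.1) fun k hk => ?_
    obtain ⟨hik, hjk⟩ : G.Adj i k ∧ G.Adj j k := hk
    have hfk : f k = k := Function.update_of_ne hjk.ne' _ _
    have hi := map_dvd (rename (R := ℚ) f) (hη i k (SimpleGraph.deleteEdges_adj.2
      ⟨hik, by simp [hjk.ne', hik.ne']⟩))
    have hj := map_dvd (rename (R := ℚ) f) (hη j k (SimpleGraph.deleteEdges_adj.2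
      ⟨hjk, by simp [hjk.ne', hik.ne']⟩))
    rw [map_sub, rename_X, rename_X, hfk] at hi hj
    rw [hfi] at hi
    rw [hfj] at hj
    have := dvd_sub hi hj
    rwa [← map_sub, sub_sub_sub_cancel_right] at this
  refine ⟨c, ?_⟩
  rw [mul_comm, ← hc, X_sub_X_dvd_iff, map_sub, rename_rename, hff, sub_self]

lemma mem_logDer_iff_deleteEdges (G : SimpleGraph (Fin ℓ)) {i j : Fin ℓ} (hij : G.Adj i j)
    {θ : Derivation ℚ (Spoly ℓ) (Spoly ℓ)} :
    θ ∈ logDer ℓ G ↔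
      θ ∈ logDer ℓ (G.deleteEdges {s(i, j)}) ∧ (X i - X j) ∣ derivDiff i j θ := by
  refine ⟨fun h => ⟨fun a b hab => h a b (SimpleGraph.deleteEdges_adj.1 hab).1, h i j hij⟩, ?_⟩
  rintro ⟨h, hd⟩ a b hab
  by_cases he : s(a, b) = s(i, j)
  · rcases Sym2.eq_iff.1 he with ⟨rfl, rfl⟩ | ⟨rfl, rfl⟩
    · exact hd
    · rw [← neg_sub, neg_dvd, ← dvd_neg, neg_sub]
      exact hd
  · exact h a b (SimpleGraph.deleteEdges_adj.2 ⟨hab, he⟩)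

theorem hasProjectiveDimensionLT_two_deleteEdges (G : SimpleGraph (Fin ℓ)) {i j : Fin ℓ}
    (hij : G.Adj i j) (hcut : ¬ (avoidGraph G i j).Reachable i j)
    (h : HasProjectiveDimensionLT (ModuleCat.of (Spoly ℓ) (logDer ℓ G)) 2) :
    HasProjectiveDimensionLT
      (ModuleCat.of (Spoly ℓ) (logDer ℓ (G.deleteEdges {s(i, j)}))) 2 := by
  obtain ⟨θ, hθ, hθP⟩ := exists_mem_logDer_deleteEdges G hcut
  set α : Spoly ℓ := X i - X j
  have hα : Prime α := prime_X_sub_X hij.ne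
  have hαP : ¬ α ∣ derivDiff i j θ := by
    rw [hθP]
    exact not_X_sub_X_dvd_prodOver (fun h => G.loopless.irrefl i h.1)
      (fun h => G.loopless.irrefl j h.2) hij.ne
  let ι : logDer ℓ G →ₗ[Spoly ℓ] logDer ℓ (G.deleteEdges {s(i, j)}) :=
    Submodule.inclusion fun η hη => ((mem_logDer_iff_deleteEdges G hij).1 hη).1
  have hαθ : α • θ ∈ logDer ℓ G := by
    refine (mem_logDer_iff_deleteEdges G hij).2 ⟨Submodule.smul_mem _ _ hθ, ?_⟩
    rw [map_smul, smul_eq_mul]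
    exact dvd_mul_right _ _
  let f : Spoly ℓ →ₗ[Spoly ℓ] Spoly ℓ × logDer ℓ G :=
    LinearMap.toSpanSingleton (Spoly ℓ) (Spoly ℓ × logDer ℓ G) (α, -⟨α • θ, hαθ⟩)
  let g : Spoly ℓ × logDer ℓ G →ₗ[Spoly ℓ] logDer ℓ (G.deleteEdges {s(i, j)}) :=
    LinearMap.coprod (LinearMap.toSpanSingleton (Spoly ℓ) _ ⟨θ, hθ⟩) ι
  have hg (c : Spoly ℓ) (η : logDer ℓ G) : (g (c, η)).1 = c • θ + η.1 := rfl
  have hf (c : Spoly ℓ) : f c = (c * α, c • -⟨α • θ, hαθ⟩) := rfl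
  have hgf : g ∘ₗ f = 0 := by
    refine LinearMap.ext fun c => Subtype.ext ?_
    change (c * α) • θ + c • -(α • θ) = 0
    rw [smul_neg, mul_smul, add_neg_cancel]
  have hinj : Function.Injective f := by
    intro c c' h
    exact mul_right_cancel₀ hα.ne_zero (congrArg Prod.fst h)
  have hexact (x : Spoly ℓ × logDer ℓ G) (hx : g x = 0) : ∃ c, f c = x := by
    obtain ⟨c, η⟩ := x
    have hη : c • θ + η.1 = 0 := congrArg Subtype.val hx
    have hdvd : α ∣ c * derivDiff i j θ := by
      have h₀ := congrArg (derivDiff i j) hη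
      rw [map_add, map_smul, smul_eq_mul, map_zero] at h₀
      rw [eq_neg_of_add_eq_zero_left h₀, dvd_neg]
      exact η.2 i j hij
    obtain ⟨d, rfl⟩ := (hα.dvd_or_dvd hdvd).resolve_right hαP
    refine ⟨d, Prod.ext (mul_comm d α) (Subtype.ext ?_)⟩
    change d • -(α • θ) = η.1
    rw [eq_neg_of_add_eq_zero_right hη, smul_neg, smul_smul, mul_comm]
  have hsurj : Function.Surjective g := by
    intro η
    obtain ⟨c, hc⟩ := exists_X_sub_X_dvd_derivDiff_sub G η.2
    have hmem : η.1 - c • θ ∈ logDer ℓ G := by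
      refine (mem_logDer_iff_deleteEdges G hij).2
        ⟨Submodule.sub_mem _ η.2 (Submodule.smul_mem _ _ hθ), ?_⟩
      rwa [map_sub, map_smul, hθP]
    exact ⟨(c, ⟨η.1 - c • θ, hmem⟩), Subtype.ext (add_sub_cancel _ _)⟩
  have hzero (x : Spoly ℓ × logDer ℓ G) : (∃ c, f c = x) → g x = 0 := by
    rintro ⟨c, rfl⟩
    exact LinearMap.congr_fun hgf c
  exact hasProjectiveDimensionLT_two_of_exact (R := Spoly ℓ) (D := logDer ℓ G)
    (D' := logDer ℓ (G.deleteEdges {s(i, j)})) f g (fun x => ⟨hexact x, hzero x⟩) hinj hsurj h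

end EdgeDeletion

/-- If `e` is an edge of `G` which lies on no induced 4-cycle of `G` and
`pd D(A(G)) ≤ 1`, then `pd D(A(G - e)) ≤ 1`. -/
theorem pd_deleteEdge_le_one (ℓ : ℕ) (hℓ : 1 ≤ ℓ) (G : SimpleGraph (Fin ℓ))
    (e : Sym2 (Fin ℓ)) (he : e ∈ G.edgeSet)
    (hC4 : ¬ ∃ s : Set (Fin ℓ), (∀ v ∈ e, v ∈ s) ∧
      Nonempty (G.induce s ≃g SimpleGraph.cycleGraph 4))
    (hpd : pd (ModuleCat.of (Spoly ℓ) (logDer ℓ G)) ≤ 1) :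
    pd (ModuleCat.of (Spoly ℓ) (logDer ℓ (G.deleteEdges {e}))) ≤ 1 := by
  induction e with
  | _ i j =>
  have hLT := hasProjectiveDimensionLT_two_of_pd_le_one hpd
  refine pd_le_one_of_hasProjectiveDimensionLT_two
    (hasProjectiveDimensionLT_two_deleteEdges G he (fun hreach => ?_) hLT)
  obtain ⟨n, v, hn, rfl, rfl, hv⟩ := exists_isInducedCycle_of_reachable G he hreach
  rcases hn.eq_or_lt with rfl | hn
  · refine hC4 ⟨v '' Set.Iic 3, ?_, hv.nonempty_iso_cycleGraph_four⟩
    rintro w hw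
    rcases Sym2.mem_iff.1 hw with rfl | rfl
    · exact ⟨0, by simp, rfl⟩
    · exact ⟨3, by simp, rfl⟩
  · exact not_hasProjectiveDimensionLT_two_of_isInducedCycle G hn hv hLT
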